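/- Let Ds, Dt : R → R be the k-linear maps satisfying αs·Ds(f) = f − σs(f) and αt·Dt(f) = f − σt(f) for all f ∈ R (such maps exist and are unique). Suppose m ≥ 2 and [m]x = [m]y = 0 in k. If m is even, then the two alternating compositions of length m agree: Ds ∘ Dt ∘ ⋯ ∘ Dt = Dt ∘ Ds ∘ ⋯ ∘ Ds (m factors each). If m is odd, then Ds ∘ Dt ∘ ⋯ ∘ Ds = [m−1]x · (Dt ∘ Ds ∘ ⋯ ∘ Dt) (m factors each); that is, in the non-symmetric case the braid relation for Demazure operators holds exactly for m even, and up to the invertible scalar λ^{−1} = [m−1]x for m odd. -/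

import Mathlib

open MvPolynomial

/-- The pair of two-colored quantum numbers `([n]x, [n]y)` attached to `x, y ∈ k`:
`[0]x = [0]y = 0`, `[1]x = [1]y = 1`, `[n+1]x = x·[n]y − [n−1]x`,
`[n+1]y = y·[n]x − [n−1]y`. -/
def tq {k : Type*} [CommRing k] (x y : k) : ℕ → k × k
  | 0 => (0, 0)
  | 1 => (1, 1)
  | n + 2 => (x * (tq x y (n + 1)).2 - (tq x y n).1,
              y * (tq x y (n + 1)).1 - (tq x y n).2)

/-- The two-colored quantum number `[n]x`. -/
def qnx {k : Type*} [CommRing k] (x y : k) (n : ℕ) : k := (tq x y n).1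

/-- The two-colored quantum number `[n]y`. -/
def qny {k : Type*} [CommRing k] (x y : k) (n : ℕ) : k := (tq x y n).2

/-- The involution `σs` of `R = k[αs, αt]` (with `αs = X 0`, `αt = X 1`) for the
non-symmetric realization: `σs(αs) = −αs`, `σs(αt) = αt + x·αs`. -/
noncomputable def σs {k : Type*} [CommRing k] (x : k) :
    MvPolynomial (Fin 2) k →ₐ[k] MvPolynomial (Fin 2) k :=
  aeval ![-(X 0), X 1 + C x * X 0]

/-- The involution `σt` of `R = k[αs, αt]` for the non-symmetric realization:
`σt(αt) = −αt`, `σt(αs) = αs + y·αt`. -/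
noncomputable def σt {k : Type*} [CommRing k] (y : k) :
    MvPolynomial (Fin 2) k →ₐ[k] MvPolynomial (Fin 2) k :=
  aeval ![X 0 + C y * X 1, -(X 1)]

/-- The alternating composition `A ∘ B ∘ A ∘ ⋯` with `n` factors,
the leftmost factor being `A`. -/
def altComp {k M : Type*} [CommRing k] [AddCommGroup M] [Module k M] :
    (M →ₗ[k] M) → (M →ₗ[k] M) → ℕ → (M →ₗ[k] M)
  | _, _, 0 => LinearMap.id
  | A, B, n + 1 => A ∘ₗ altComp B A n

/-- The `k`-linear involution of `k²` sending `(p, q)` to the coordinates of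
`σs (p αs + q αt)`. -/
def reflS {k : Type*} [CommRing k] (x : k) : (k × k) →ₗ[k] (k × k) where
  toFun v := (x * v.2 - v.1, v.2)
  map_add' v w := by ext <;> simp; ring
  map_smul' a v := by ext <;> simp; ring

/-- The `k`-linear involution of `k²` sending `(p, q)` to the coordinates of
`σt (p αs + q αt)`. -/
def reflT {k : Type*} [CommRing k] (y : k) : (k × k) →ₗ[k] (k × k) where
  toFun v := (v.1, y * v.1 - v.2)
  map_add' v w := by ext <;> simp; ring
  map_smul' a v := by ext <;> simp; ring

/-- The linear form `p αs + q αt` attached to `(p, q)`. -/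
noncomputable def linForm {k : Type*} [CommRing k] :
    (k × k) →ₗ[k] MvPolynomial (Fin 2) k where
  toFun v := C v.1 * X 0 + C v.2 * X 1
  map_add' v w := by simp; ring
  map_smul' a v := by simp [smul_eq_C_mul]; ring

/-- The pair `([2j]/x, [2j+1])`, as a function of `z = xy`. -/
def halfQn {k : Type*} [CommRing k] (z : k) : ℕ → k × k
  | 0 => (0, 1)
  | j + 1 => ((halfQn z j).2 - (halfQn z j).1,
      z * ((halfQn z j).2 - (halfQn z j).1) - (halfQn z j).2)

theorem tq_eq_halfQn {k : Type*} [CommRing k] (x y : k) (j : ℕ) :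
    tq x y (2 * j) = (x * (halfQn (x * y) j).1, y * (halfQn (x * y) j).1) ∧
    tq x y (2 * j + 1) = ((halfQn (x * y) j).2, (halfQn (x * y) j).2) := by
  induction j with
  | zero => simp [tq, halfQn]
  | succ j ih =>
    obtain ⟨h0, h1⟩ := ih
    have h2 : tq x y (2 * (j + 1)) =
        (x * (halfQn (x * y) (j + 1)).1, y * (halfQn (x * y) (j + 1)).1) := by
      rw [show 2 * (j + 1) = 2 * j + 2 by ring, tq, h0, h1]
      ext <;> simp [halfQn] <;> ring
    refine ⟨h2, ?_⟩
    rw [show 2 * (j + 1) + 1 = (2 * j + 1) + 2 by ring, tq, h1,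
      show 2 * j + 1 + 1 = 2 * (j + 1) by ring, h2]
    ext <;> simp [halfQn] <;> ring

theorem halfQn_invariant {k : Type*} [CommRing k] (z : k) (j : ℕ) :
    (halfQn z j).2 ^ 2 - z * (halfQn z j).1 * (halfQn z j).2 + z * (halfQn z j).1 ^ 2 = 1 := by
  induction j with
  | zero => simp [halfQn]
  | succ j ih =>
    simp only [halfQn]
    linear_combination ih

theorem halfQn_two_mul {k : Type*} [CommRing k] (z : k) (j : ℕ) :
    halfQn z (2 * j) =
      ((halfQn z j).1 * (2 * (halfQn z j).2 - z * (halfQn z j).1),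
        1 + z * (halfQn z j).1 * ((halfQn z j).2 - 2 * (halfQn z j).1)) := by
  induction j with
  | zero => simp [halfQn]
  | succ j ih =>
    have h := halfQn_invariant z j
    rw [show 2 * (j + 1) = 2 * j + 1 + 1 by ring]
    simp only [halfQn, ih]
    generalize (halfQn z j).1 = u at *
    generalize (halfQn z j).2 = v at *
    ext
    · simp only
      linear_combination (2 - z) * h
    · simp only
      linear_combination (3 * z - z ^ 2) * h

theorem altComp_refl_two_mul {k : Type*} [CommRing k] (x y : k) (j : ℕ) (v : k × k) :
    altComp (reflS x) (reflT y) (2 * j) v =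
      ((halfQn (x * y) j).2 * v.1 - x * (halfQn (x * y) j).1 * v.2,
        y * (halfQn (x * y) j).1 * v.1 +
          ((halfQn (x * y) j).2 - x * y * (halfQn (x * y) j).1) * v.2) ∧
    altComp (reflT y) (reflS x) (2 * j) v =
      (((halfQn (x * y) j).2 - x * y * (halfQn (x * y) j).1) * v.1 +
          x * (halfQn (x * y) j).1 * v.2,
        (halfQn (x * y) j).2 * v.2 - y * (halfQn (x * y) j).1 * v.1) := by
  induction j with
  | zero => simp [altComp, halfQn]
  | succ j ih =>
    rw [show 2 * (j + 1) = 2 * j + 1 + 1 by ring]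
    simp only [altComp, LinearMap.comp_apply, ih.1, ih.2]
    simp only [reflS, reflT, halfQn, LinearMap.coe_mk, AddHom.coe_mk]
    constructor <;> ext <;> simp only <;> ring

theorem altComp_add {k M : Type*} [CommRing k] [AddCommGroup M] [Module k M]
    (A B : M →ₗ[k] M) (n p : ℕ) :
    ∃ F : M →ₗ[k] M, altComp A B (n + p) = altComp A B n ∘ₗ F := by
  induction n generalizing A B with
  | zero => exact ⟨altComp A B p, by simp [altComp]⟩
  | succ n ih =>
    obtain ⟨F, hF⟩ := ih B A
    refine ⟨F, ?_⟩
    rw [show n + 1 + p = n + p + 1 by ring, altComp, altComp, hF, LinearMap.comp_assoc]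

theorem smul_altComp_eq_zero_of_le {k M : Type*} [CommRing k] [AddCommGroup M] [Module k M]
    {A B : M →ₗ[k] M} {τ : k} {n m : ℕ} (hnm : n ≤ m) (h : τ • altComp A B n = 0) :
    τ • altComp A B m = 0 := by
  obtain ⟨p, rfl⟩ := Nat.exists_eq_add_of_le hnm
  obtain ⟨F, hF⟩ := altComp_add A B n p
  rw [hF, ← LinearMap.smul_comp, h, LinearMap.zero_comp]

theorem altComp_apply_eq_zero {k M : Type*} [CommRing k] [AddCommGroup M] [Module k M]
    {A B : M →ₗ[k] M} {u : M} (hA : A u = 0) (hB : B u = 0) (n : ℕ) :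
    altComp A B (n + 1) u = 0 := by
  induction n generalizing A B with
  | zero => simpa [altComp] using hA
  | succ n ih => rw [altComp, LinearMap.comp_apply, ih hB hA, map_zero]

/-- Commutation of an alternating composition of twisted derivations of square zero with
multiplication by a linear form: only the terms deleting the first or last factor survive. -/
theorem altComp_mul {k R V : Type*} [CommRing k] [CommRing R] [Algebra k R]
    [AddCommGroup V] [Module k V] (L : V →ₗ[k] R)
    {A B : R →ₗ[k] R} {a b : V →ₗ[k] V} {φ ψ : V → k}
    (hA : ∀ v f, A (L v * f) = L (a v) * A f + φ v • f)
    (hB : ∀ v f, B (L v * f) = L (b v) * B f + ψ v • f)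
    (hAA : ∀ f, A (A f) = 0) (hBB : ∀ f, B (B f) = 0) (n : ℕ) (v : V) (f : R) :
    altComp A B (n + 2) (L v * f) =
      L (altComp a b (n + 2) v) * altComp A B (n + 2) f
        + φ (altComp b a (n + 1) v) • altComp B A (n + 1) f
        + (if Even n then ψ v else φ v) • altComp A B (n + 1) f := by
  induction n generalizing A B a b φ ψ with
  | zero => simp [altComp, hA, hB]
  | succ n ih =>
    rw [altComp, LinearMap.comp_apply, ih hB hA hBB hAA]
    simp only [map_add, map_smul, hA]
    have h0 : A (altComp A B (n + 1) f) = 0 := by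
      rw [altComp, LinearMap.comp_apply, hAA]
    rw [h0]
    simp only [altComp, LinearMap.comp_apply, Nat.even_add_one, smul_zero, add_zero, ite_not]

theorem eq_zero_of_linForm_mul {k : Type*} [CommRing k]
    (E : MvPolynomial (Fin 2) k →ₗ[k] MvPolynomial (Fin 2) k) (h1 : E 1 = 0)
    (h : ∀ v f, ∃ g, E (linForm v * f) = g * E f) : E = 0 := by
  refine LinearMap.ext fun f => ?_
  induction f using MvPolynomial.induction_on with
  | C a => rw [← mul_one (C a), ← smul_eq_C_mul, map_smul, h1, smul_zero, LinearMap.zero_apply]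
  | add f g hf hg => rw [map_add, hf, hg, map_add]
  | mul_X f i ih =>
    have hX : ∃ v : k × k, linForm v = (X i : MvPolynomial (Fin 2) k) := by
      fin_cases i
      · exact ⟨(1, 0), by simp [linForm]⟩
      · exact ⟨(0, 1), by simp [linForm]⟩
    obtain ⟨v, hv⟩ := hX
    obtain ⟨g, hg⟩ := h v f
    rw [mul_comm, ← hv, hg, ih, LinearMap.zero_apply, mul_zero, LinearMap.zero_apply]

theorem twisted_leibniz {k R : Type*} [CommRing k] [CommRing R] [Algebra k R]
    {a : R} (ha : IsLeftRegular a) (σ : R →ₐ[k] R) (D : R →ₗ[k] R)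
    (hD : ∀ f, a * D f = f - σ f) {l l' : R} {c : k} (hl : σ l = l') (hc : l - l' = c • a)
    (f : R) : D (l * f) = l' * D f + c • f := by
  apply ha
  change a * D (l * f) = a * (l' * D f + c • f)
  rw [hD, map_mul, hl, mul_add, mul_left_comm, hD, mul_smul_comm, ← smul_mul_assoc, ← hc]
  ring

theorem demazure_comp_self {k R : Type*} [CommRing k] [CommRing R] [Algebra k R]
    {a : R} (ha : IsLeftRegular a) (σ : R →ₐ[k] R) (D : R →ₗ[k] R)
    (hD : ∀ f, a * D f = f - σ f) (hσa : σ a = -a) (hσ : ∀ f, σ (σ f) = f) (f : R) :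
    D (D f) = 0 := by
  have h : σ (D f) = D f := by
    apply ha
    change a * σ (D f) = a * D f
    have h2 := congrArg σ (hD f)
    rw [map_mul, map_sub, hσa, hσ] at h2
    rw [hD]
    linear_combination -h2
  apply ha
  change a * D (D f) = a * 0
  rw [hD, h, sub_self, mul_zero]

/-- The commutation relations of the two Demazure operators with linear forms, together with
`Ds² = Dt² = 0` and `Ds 1 = Dt 1 = 0`. -/
structure DemazureRelations {k : Type*} [CommRing k] (x y : k)
    (Ds Dt : MvPolynomial (Fin 2) k →ₗ[k] MvPolynomial (Fin 2) k) : Prop where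
  s_mul : ∀ v f, Ds (linForm v * f) = linForm (reflS x v) * Ds f + (2 * v.1 - x * v.2) • f
  t_mul : ∀ v f, Dt (linForm v * f) = linForm (reflT y v) * Dt f + (2 * v.2 - y * v.1) • f
  s_sq : ∀ f, Ds (Ds f) = 0
  t_sq : ∀ f, Dt (Dt f) = 0
  s_one : Ds 1 = 0
  t_one : Dt 1 = 0

theorem demazureRelations {k : Type*} [CommRing k] (x y : k)
    (Ds Dt : MvPolynomial (Fin 2) k →ₗ[k] MvPolynomial (Fin 2) k)
    (hDs : ∀ f, X 0 * Ds f = f - σs x f) (hDt : ∀ f, X 1 * Dt f = f - σt y f) :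
    DemazureRelations x y Ds Dt := by
  have r0 : IsLeftRegular (X 0 : MvPolynomial (Fin 2) k) := isRegular_X.left
  have r1 : IsLeftRegular (X 1 : MvPolynomial (Fin 2) k) := isRegular_X.left
  refine ⟨fun v f => ?_, fun v f => ?_, ?_, ?_, ?_, ?_⟩
  · refine twisted_leibniz r0 (σs x) Ds hDs ?_ ?_ f
    · simp [linForm, reflS, σs, algebraMap_eq]; ring
    · simp [linForm, reflS, smul_eq_C_mul, map_ofNat C 2]; ring
  · refine twisted_leibniz r1 (σt y) Dt hDt ?_ ?_ f
    · simp [linForm, reflT, σt, algebraMap_eq]; ring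
    · simp [linForm, reflT, smul_eq_C_mul, map_ofNat C 2]; ring
  · refine demazure_comp_self r0 (σs x) Ds hDs (by simp [σs]) fun f => ?_
    suffices h : (σs x).comp (σs x) = AlgHom.id k _ from DFunLike.congr_fun h f
    ext i : 1
    fin_cases i <;> simp [σs, algebraMap_eq]
  · refine demazure_comp_self r1 (σt y) Dt hDt (by simp [σt]) fun f => ?_
    suffices h : (σt y).comp (σt y) = AlgHom.id k _ from DFunLike.congr_fun h f
    ext i : 1
    fin_cases i <;> simp [σt, algebraMap_eq]
  · apply r0
    simp [hDs]
  · apply r1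
    simp [hDt]

namespace DemazureRelations

variable {k : Type*} [CommRing k] {x y : k}
  {Ds Dt : MvPolynomial (Fin 2) k →ₗ[k] MvPolynomial (Fin 2) k}

/-- Reduction of a scaled braid relation to identities between the coefficients in the
commutation relations with linear forms. -/
theorem smul_altComp_eq (h : DemazureRelations x y Ds Dt) (n : ℕ) (τ c : k)
    (hw : ∀ v, τ • altComp (reflS x) (reflT y) (n + 2) v =
      τ • altComp (reflT y) (reflS x) (n + 2) v)
    (hs : ∀ v f, (τ * (2 * (altComp (reflT y) (reflS x) (n + 1) v).1 -
          x * (altComp (reflT y) (reflS x) (n + 1) v).2)) • altComp Dt Ds (n + 1) f =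
      (τ * c * (if Even n then 2 * v.1 - x * v.2 else 2 * v.2 - y * v.1)) •
        altComp Dt Ds (n + 1) f)
    (ht : ∀ v f, (τ * c * (2 * (altComp (reflS x) (reflT y) (n + 1) v).2 -
          y * (altComp (reflS x) (reflT y) (n + 1) v).1)) • altComp Ds Dt (n + 1) f =
      (τ * (if Even n then 2 * v.2 - y * v.1 else 2 * v.1 - x * v.2)) •
        altComp Ds Dt (n + 1) f) :
    τ • altComp Ds Dt (n + 2) = τ • c • altComp Dt Ds (n + 2) := by
  rw [← sub_eq_zero]
  apply eq_zero_of_linForm_mul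
  · simp [altComp_apply_eq_zero h.s_one h.t_one (n + 1),
      altComp_apply_eq_zero h.t_one h.s_one (n + 1)]
  · intro v f
    refine ⟨linForm (altComp (reflS x) (reflT y) (n + 2) v), ?_⟩
    have hw' := congrArg linForm (hw v)
    rw [map_smul, map_smul] at hw'
    have e1 := altComp_mul linForm (φ := fun v => 2 * v.1 - x * v.2)
      (ψ := fun v => 2 * v.2 - y * v.1) h.s_mul h.t_mul h.s_sq h.t_sq n v f
    have e2 := altComp_mul linForm (φ := fun v => 2 * v.2 - y * v.1)
      (ψ := fun v => 2 * v.1 - x * v.2) h.t_mul h.s_mul h.t_sq h.s_sq n v f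
    have hs' := hs v f
    have ht' := ht v f
    simp only [LinearMap.sub_apply, LinearMap.smul_apply, e1, e2]
    simp only [smul_eq_C_mul, C_mul] at hw' hs' ht' ⊢
    linear_combination hs' - ht' + C c * altComp Dt Ds (n + 2) f * hw'

theorem smul_braid_odd (h : DemazureRelations x y Ds Dt) (j : ℕ) (τ : k)
    (hτ : τ * (halfQn (x * y) j).2 = 0) :
    τ • altComp Ds Dt (2 * j + 1) =
      τ • (x * (halfQn (x * y) j).1) • altComp Dt Ds (2 * j + 1) := by
  cases j with
  | zero =>
    have : τ = 0 := by simpa [halfQn] using hτ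
    simp [this]
  | succ i =>
    have hodd : ¬ Even (2 * i + 1) := by simp
    have hw := altComp_refl_two_mul x y (i + 1)
    have hv := halfQn_invariant (x * y) (i + 1)
    rw [show 2 * (i + 1) + 1 = 2 * i + 1 + 2 by ring]
    generalize (halfQn (x * y) (i + 1)).1 = u at *
    generalize (halfQn (x * y) (i + 1)).2 = w at *
    rw [show 2 * (i + 1) = 2 * i + 1 + 1 by ring] at hw
    refine h.smul_altComp_eq _ _ _ (fun v => ?_) (fun v f => ?_) (fun v f => ?_)
    · rw [altComp, altComp.eq_2 _ _ (2 * i + 1 + 1), LinearMap.comp_apply,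
        LinearMap.comp_apply, (hw v).1, (hw v).2]
      ext
      · simp [reflS, reflT]
        linear_combination (x * v.2 - 2 * v.1) * hτ
      · simp [reflS, reflT]
        linear_combination (2 * v.2 - y * v.1) * hτ
    · rw [(hw v).2, if_neg hodd]
      congr 1
      linear_combination (2 * v.1 - x * v.2) * hτ
    · rw [(hw v).1, if_neg hodd]
      congr 1
      linear_combination (-x * y * u * v.1 + 2 * x * u * v.2 +
        (2 * v.1 - x * v.2) * (x * y * u - w)) * hτ + τ * (2 * v.1 - x * v.2) * hv

/-- A scaled braid relation of length `n` with scalar invertible modulo the annihilator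
of `τ` kills all longer alternating compositions. -/
theorem smul_altComp_eq_zero (h : DemazureRelations x y Ds Dt) {n m : ℕ} (hnm : n + 2 ≤ m)
    {τ c d : k} (hcd : τ * (c * d) = τ)
    (hb : τ • altComp Ds Dt (n + 1) = τ • c • altComp Dt Ds (n + 1)) :
    τ • altComp Ds Dt m = 0 ∧ τ • altComp Dt Ds m = 0 := by
  have hb' : τ • altComp Dt Ds (n + 1) = d • τ • altComp Ds Dt (n + 1) := by
    rw [hb]
    simp only [smul_smul]
    congr 1
    linear_combination -hcd
  constructor
  · refine smul_altComp_eq_zero_of_le hnm ?_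
    rw [altComp, ← LinearMap.comp_smul, hb']
    refine LinearMap.ext fun f => ?_
    simp [altComp, h.s_sq]
  · refine smul_altComp_eq_zero_of_le hnm ?_
    rw [altComp, ← LinearMap.comp_smul, hb]
    refine LinearMap.ext fun f => ?_
    simp [altComp, h.t_sq]

theorem smul_braid_even (h : DemazureRelations x y Ds Dt) (r : ℕ) (τ : k)
    (hx : τ * (x * (halfQn (x * y) r).1) = 0) (hy : τ * (y * (halfQn (x * y) r).1) = 0) :
    τ • altComp Ds Dt (2 * r) = τ • altComp Dt Ds (2 * r) := by
  induction r using Nat.strong_induction_on generalizing τ with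
  | _ r ih =>
  cases r with
  | zero => rfl
  | succ i =>
    have key : (τ * ((halfQn (x * y) i).2 - 1)) • altComp Ds Dt (2 * i + 1) = 0 ∧
        (τ * ((halfQn (x * y) i).2 - 1)) • altComp Dt Ds (2 * i + 1) = 0 := by
      obtain ⟨j, rfl | rfl⟩ := Nat.even_or_odd' i
      · have hd := halfQn_two_mul (x * y) j
        have hv := halfQn_invariant (x * y) j
        rcases j with _ | j
        · simp [halfQn]
        have hodd := h.smul_braid_odd (j + 1)
          (τ * x * ((halfQn (x * y) (j + 1)).2 - 2 * (halfQn (x * y) (j + 1)).1))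
        simp only [halfQn.eq_2 (x * y) (2 * (j + 1)), hd] at hx hy ⊢
        generalize (halfQn (x * y) (j + 1)).1 = u at *
        generalize (halfQn (x * y) (j + 1)).2 = v at *
        have h0 : τ * x * (v - 2 * u) * v = 0 := by
          linear_combination hx + τ * x * hv
        have := h.smul_altComp_eq_zero (n := 2 * (j + 1)) (m := 2 * (2 * (j + 1)) + 1)
          (by lia) (c := x * u) (d := y * u)
          (by linear_combination (τ * x * (v - 2 * u)) * hv - (v - x * y * u) * h0) (hodd h0)
        rw [show τ * (1 + x * y * u * (v - 2 * u) - 1) = (y * u) * (τ * x * (v - 2 * u)) by ring,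
          mul_smul _ (τ * x * (v - 2 * u)), mul_smul _ (τ * x * (v - 2 * u)), this.1, this.2]
        simp
      · have hd := halfQn_two_mul (x * y) (j + 1)
        have hv := halfQn_invariant (x * y) (j + 1)
        have hE := ih (j + 1) (by lia)
          (τ * (2 * (halfQn (x * y) (j + 1)).2 - x * y * (halfQn (x * y) (j + 1)).1))
        have hO : (halfQn (x * y) (2 * j + 1)).2 =
            x * y * (halfQn (x * y) (2 * j + 1 + 1)).1 - (halfQn (x * y) (2 * j + 1 + 1)).2 := by
          simp only [halfQn]
          ring
        rw [hO]
        simp only [show 2 * j + 1 + 1 = 2 * (j + 1) by ring, hd] at hx hy ⊢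
        generalize (halfQn (x * y) (j + 1)).1 = u at *
        generalize (halfQn (x * y) (j + 1)).2 = v at *
        have := h.smul_altComp_eq_zero (n := 2 * j + 1) (m := 2 * (2 * j + 1) + 1)
          (τ := τ * (2 * v - x * y * u)) (by lia) (c := 1) (d := 1) (by ring)
          (by rw [one_smul]; exact hE (by linear_combination hx) (by linear_combination hy))
        rw [show τ * (x * y * (u * (2 * v - x * y * u)) - (1 + x * y * u * (v - 2 * u)) - 1) =
            (x * y * u - v) * (τ * (2 * v - x * y * u)) by linear_combination 2 * τ * hv,
          mul_smul _ (τ * (2 * v - x * y * u)), mul_smul _ (τ * (2 * v - x * y * u)),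
          this.1, this.2]
        simp
    have hw := altComp_refl_two_mul x y (i + 1)
    have hw' := altComp_refl_two_mul x y i
    have hb := h.smul_altComp_eq (2 * i) τ 1 (fun v => ?_) (fun v f => ?_) (fun v f => ?_)
    · rwa [one_smul] at hb
    · rw [show 2 * i + 2 = 2 * (i + 1) by ring, (hw v).1, (hw v).2]
      ext
      · simp only [Prod.smul_mk, smul_eq_mul]
        linear_combination (y * v.1 - 2 * v.2) * hx
      · simp only [Prod.smul_mk, smul_eq_mul]
        linear_combination (2 * v.1 - x * v.2) * hy
    · have hk := LinearMap.congr_fun key.2 f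
      rw [LinearMap.smul_apply, LinearMap.zero_apply] at hk
      rw [if_pos (even_two_mul i), ← sub_eq_zero, ← sub_smul]
      rw [altComp.eq_2 (reflT y), LinearMap.comp_apply, (hw' v).1]
      simp only [reflT, halfQn, LinearMap.coe_mk, AddHom.coe_mk] at hx ⊢
      convert smul_eq_zero_of_right (2 * v.1 - x * v.2) hk using 1
      rw [smul_smul]
      congr 1
      linear_combination (2 * v.2 - y * v.1) * hx
    · have hk := LinearMap.congr_fun key.1 f
      rw [LinearMap.smul_apply, LinearMap.zero_apply] at hk
      rw [if_pos (even_two_mul i), ← sub_eq_zero, ← sub_smul]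
      rw [altComp.eq_2 (reflS x), LinearMap.comp_apply, (hw' v).2]
      simp only [reflS, halfQn, LinearMap.coe_mk, AddHom.coe_mk] at hy ⊢
      convert smul_eq_zero_of_right (2 * v.2 - y * v.1) hk using 1
      rw [smul_smul]
      congr 1
      linear_combination (2 * v.1 - x * v.2) * hy

end DemazureRelations

/-- Let `Ds, Dt` be the simple Demazure operators for the non-symmetric realization with
Cartan entries `a(s,t) = −x`, `a(t,s) = −y`, and suppose `m ≥ 2` with
`[m]x = [m]y = 0`.  For `m` even the braid relation holds on the nose:
`Ds ∘ Dt ∘ ⋯ ∘ Dt = Dt ∘ Ds ∘ ⋯ ∘ Ds` (`m` factors each); for `m` odd it holds up to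
the invertible scalar `λ⁻¹ = [m−1]x`:
`Ds ∘ Dt ∘ ⋯ ∘ Ds = [m−1]x · (Dt ∘ Ds ∘ ⋯ ∘ Dt)`. -/
theorem nonsymmetric_demazure_braid {k : Type*} [CommRing k] (x y : k)
    (Ds Dt : MvPolynomial (Fin 2) k →ₗ[k] MvPolynomial (Fin 2) k)
    (hDs : ∀ f, X 0 * Ds f = f - σs x f)
    (hDt : ∀ f, X 1 * Dt f = f - σt y f)
    (m : ℕ) (hm : 2 ≤ m) (hx : qnx x y m = 0) (hy : qny x y m = 0) :
    (Even m → altComp Ds Dt m = altComp Dt Ds m) ∧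
    (Odd m → altComp Ds Dt m = qnx x y (m - 1) • altComp Dt Ds m) := by
  have h := demazureRelations x y Ds Dt hDs hDt
  unfold qnx at *
  unfold qny at hy
  constructor
  · intro hm'
    obtain ⟨r, rfl⟩ := even_iff_two_dvd.mp hm'
    rw [(tq_eq_halfQn x y r).1] at hx hy
    simpa using h.smul_braid_even r 1 (by simpa using hx) (by simpa using hy)
  · rintro ⟨j, rfl⟩
    rw [(tq_eq_halfQn x y j).2] at hx
    rw [Nat.add_sub_cancel, (tq_eq_halfQn x y j).1]
    simpa using h.smul_braid_odd j 1 (by simpa using hx)
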